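/- There is no effective (faithful) action of the group (ℤ/3ℤ) × (ℤ/3ℤ) on the 2-sphere S² by homeomorphisms. That is, there is no injective group homomorphism from (ZMod 3) × (ZMod 3) into the group of self-homeomorphisms of the unit sphere S² = {x ∈ ℝ³ : ‖x‖ = 1}. -/

import Mathlib

open Set Metric Filter Topology Bornology

/-- A nowhere vanishing continuous function on an open convex set has a continuous logarithm. -/
theorem exists_continuousOn_log_of_convex {E : Type*} [NormedAddCommGroup E] [NormedSpace ℝ E]
    {s : Set E} (hs : Convex ℝ s) (ho : IsOpen s) {f : E → ℂ} (hf : ContinuousOn f s)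
    (h0 : ∀ x ∈ s, f x ≠ 0) :
    ∃ φ : E → ℂ, ContinuousOn φ s ∧ ∀ x ∈ s, f x = Complex.exp (φ x) := by
  rcases s.eq_empty_or_nonempty with rfl | ⟨a, ha⟩
  · exact ⟨0, by simp, by simp⟩
  have := hs.contractibleSpace ⟨a, ha⟩
  have := ho.locallyPathConnectedSpace
  obtain ⟨F, ⟨-, hF⟩, -⟩ :=
    Complex.isCoveringMapOn_exp.existsUnique_continuousMap_lifts (A := s)
      ⟨s.domRestrict f, hf.domRestrict⟩ (a₀ := ⟨a, ha⟩) (e₀ := Complex.log (f a))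
      (Complex.exp_log (h0 a ha)) (fun x => h0 x x.2)
  refine ⟨fun x => open Classical in if h : x ∈ s then F ⟨x, h⟩ else 0, ?_, ?_⟩
  · rw [continuousOn_iff_continuous_domRestrict]
    convert F.continuous using 1
    ext x
    simp
  · intro x hx
    have := congrFun hF ⟨x, hx⟩
    simpa [hx] using! this.symm

/-- A nowhere vanishing continuous function on an open subset of the line has a continuous
logarithm. -/
theorem exists_continuousOn_log_of_isOpen_real {W : Set ℝ} (hW : IsOpen W) {f : ℝ → ℂ}
    (hf : ContinuousOn f W) (h0 : ∀ x ∈ W, f x ≠ 0) :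
    ∃ φ : ℝ → ℂ, ContinuousOn φ W ∧ ∀ x ∈ W, f x = Complex.exp (φ x) := by
  have key : ∀ I : Set ℝ, ∃ φ : ℝ → ℂ, (∃ x, I = connectedComponentIn W x) →
      ContinuousOn φ I ∧ ∀ x ∈ I, f x = Complex.exp (φ x) := by
    intro I
    by_cases h : ∃ x, I = connectedComponentIn W x
    · obtain ⟨x, rfl⟩ := h
      obtain ⟨φ, h1, h2⟩ := exists_continuousOn_log_of_convex
        (isPreconnected_connectedComponentIn (F := W) (x := x)).ordConnected.convex
        hW.connectedComponentIn (hf.mono (connectedComponentIn_subset W x))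
        (fun y hy => h0 y (connectedComponentIn_subset W x hy))
      exact ⟨φ, fun _ => ⟨h1, h2⟩⟩
    · exact ⟨0, fun h' => (h h').elim⟩
  choose Φ hΦ using key
  refine ⟨fun x => Φ (connectedComponentIn W x) x, ?_, ?_⟩
  · intro x hx
    have hI := hW.connectedComponentIn (x := x)
    have hxI := mem_connectedComponentIn hx
    have hc := ((hΦ _ ⟨x, rfl⟩).1.continuousAt (hI.mem_nhds hxI))
    refine (hc.congr ?_).continuousWithinAt
    filter_upwards [hI.mem_nhds hxI] with y hy
    rw [connectedComponentIn_eq hy]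
  · intro x hx
    exact (hΦ _ ⟨x, rfl⟩).2 x (mem_connectedComponentIn hx)

/-- A continuous function taking countably many values on a preconnected set is constant there. -/
theorem IsPreconnected.eq_of_countable_image {X : Type*} [TopologicalSpace X] {s : Set X}
    (hs : IsPreconnected s) {φ : X → ℂ} (hφ : ContinuousOn φ s) (hc : (φ '' s).Countable)
    {x y : X} (hx : x ∈ s) (hy : y ∈ s) : φ x = φ y :=
  hc.isTotallyDisconnected _ subset_rfl (hs.image φ hφ) (mem_image_of_mem φ hx)
    (mem_image_of_mem φ hy)

/-- A continuous function whose exponential is constant on a preconnected set is constant there. -/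
theorem IsPreconnected.eq_of_exp_eq_const {X : Type*} [TopologicalSpace X] {s : Set X}
    (hs : IsPreconnected s) {φ : X → ℂ} (hφ : ContinuousOn φ s) {c : ℂ}
    (hc : ∀ x ∈ s, Complex.exp (φ x) = c) {x y : X} (hx : x ∈ s) (hy : y ∈ s) : φ x = φ y := by
  refine hs.eq_of_countable_image hφ ?_ hx hy
  refine (countable_range fun n : ℤ => φ x + n * (2 * Real.pi * Complex.I)).mono ?_
  rintro _ ⟨z, hz, rfl⟩
  obtain ⟨n, hn⟩ := Complex.exp_eq_exp_iff_exists_int.1 ((hc z hz).trans (hc x hx).symm)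
  exact ⟨n, hn.symm⟩

/-- Tietze extension for a relatively closed subset of a set. -/
theorem exists_continuousOn_extension {Y A : Set ℂ} (hA : A ⊆ Y) {C : Set ℂ} (hC : IsClosed C)
    (hAC : Y ∩ C = A) {φ : ℂ → ℂ} (hφ : ContinuousOn φ A) :
    ∃ Φ : ℂ → ℂ, ContinuousOn Φ Y ∧ EqOn Φ φ A := by
  subst hAC
  have hcl : IsClosed ((↑) ⁻¹' C : Set Y) := hC.preimage continuous_subtype_val
  let f : C(((↑) ⁻¹' C : Set Y), ℂ) :=
    ⟨fun x => φ x, hφ.comp_continuous (by fun_prop) (fun x => ⟨x.1.2, x.2⟩)⟩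
  obtain ⟨g, hg⟩ := f.exists_restrict_eq hcl
  refine ⟨fun x => open Classical in if h : x ∈ Y then g ⟨x, h⟩ else 0, ?_, ?_⟩
  · rw [continuousOn_iff_continuous_domRestrict]
    convert g.continuous using 1
    ext x
    simp
  · intro x hx
    have := DFunLike.congr_fun hg ⟨⟨x, hx.1⟩, hx.2⟩
    simpa [hx.1] using! this

/-- A nowhere vanishing continuous function on the complement of a closed disc is a power of the
coordinate up to an exponential. -/
theorem exists_zpow_mul_exp_of_lt_norm (c : ℂ) {R : ℝ} (hR : 0 ≤ R) {u : ℂ → ℂ}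
    (hu : ContinuousOn u {z | R < ‖z - c‖}) (h0 : ∀ z, R < ‖z - c‖ → u z ≠ 0) :
    ∃ (n : ℤ) (φ : ℂ → ℂ), ContinuousOn φ {z | R < ‖z - c‖} ∧
      ∀ z, R < ‖z - c‖ → u z = (z - c) ^ n * Complex.exp (φ z) := by
  set H : Set ℂ := {w | R < Real.exp w.re} with hH
  have hHo : IsOpen H := isOpen_lt continuous_const (by fun_prop)
  have hHc : Convex ℝ H := by
    have : (Real.exp ⁻¹' Ioi R).OrdConnected :=
      ((isUpperSet_Ioi R).preimage Real.exp_monotone).ordConnected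
    exact this.convex.is_linear_preimage Complex.reLm.isLinear
  have hnorm : ∀ w, ‖(c + Complex.exp w) - c‖ = Real.exp w.re := fun w => by
    simp [Complex.norm_exp]
  obtain ⟨θ, hθ, hθe⟩ := exists_continuousOn_log_of_convex hHc hHo
    (f := fun w => u (c + Complex.exp w))
    (hu.comp (by fun_prop) (fun w hw => by
      simpa only [hH, mem_ofPred_eq, hnorm] using hw))
    (fun w hw => h0 _ (by
      simpa only [hH, mem_ofPred_eq, hnorm] using hw))
  have hper : ∀ w ∈ H, w + 2 * Real.pi * Complex.I ∈ H := fun w hw => by simpa [H] using hw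
  have hper' : ∀ w ∉ H, w + 2 * Real.pi * Complex.I ∉ H := fun w hw => by simpa [H] using hw
  have hexp : ∀ w ∈ H, Complex.exp (θ (w + 2 * Real.pi * Complex.I) - θ w) = 1 := by
    intro w hw
    rw [Complex.exp_sub, ← hθe _ hw, ← hθe _ (hper w hw), Complex.exp_periodic,
      div_self (h0 _ (by
      simpa only [hH, mem_ofPred_eq, hnorm] using hw))]
  obtain ⟨w₀, hw₀⟩ : H.Nonempty := ⟨((R : ℝ) : ℂ), by
    simp only [hH, mem_ofPred_eq, Complex.ofReal_re]
    linarith [Real.add_one_le_exp R]⟩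
  obtain ⟨n, hn⟩ := Complex.exp_eq_one_iff.1 (hexp w₀ hw₀)
  have hconst : ∀ w ∈ H, θ (w + 2 * Real.pi * Complex.I) - θ w = n * (2 * Real.pi * Complex.I) := by
    intro w hw
    rw [← hn]
    exact hHc.isPreconnected.eq_of_exp_eq_const
      ((hθ.comp (by fun_prop) hper).sub hθ) hexp hw hw₀
  set κ : ℂ → ℂ := H.indicator fun w => θ w - n * w with hκ
  have hκc : ContinuousOn κ H := by
    refine ContinuousOn.congr (f := fun w => θ w - n * w) (by fun_prop) ?_
    intro w hw
    simp [hκ, hw]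
  have hκp : Function.Periodic κ (2 * Real.pi * Complex.I) := by
    intro w
    by_cases hw : w ∈ H
    · simp only [hκ, indicator_of_mem hw, indicator_of_mem (hper w hw)]
      linear_combination hconst w hw
    · simp only [hκ, indicator_of_notMem hw, indicator_of_notMem (hper' w hw)]
  have hκe : ∀ a b, Complex.exp a = Complex.exp b → κ a = κ b := by
    intro a b hab
    obtain ⟨k, rfl⟩ := Complex.exp_eq_exp_iff_exists_int.1 hab
    exact hκp.int_mul k b
  have hmem : ∀ z w, R < ‖z - c‖ → Complex.exp w = z - c → w ∈ H := by
    intro z w hz hw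
    simpa only [hH, mem_ofPred_eq, ← Complex.norm_exp, hw] using hz
  have hne : ∀ z, R < ‖z - c‖ → z - c ≠ 0 := fun z hz => norm_pos_iff.1 (hR.trans_lt hz)
  refine ⟨n, fun z => κ (Complex.log (z - c)), ?_, ?_⟩
  · intro z₀ hz₀
    have hz₀' := hne z₀ hz₀
    have hlog : ContinuousAt
        (fun z => Complex.log ((z - c) / (z₀ - c)) + Complex.log (z₀ - c)) z₀ := by
      refine ContinuousAt.add (ContinuousAt.clog (by fun_prop) ?_) continuousAt_const
      simp [div_self hz₀']
    have h1 : ContinuousAt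
        (fun z => κ (Complex.log ((z - c) / (z₀ - c)) + Complex.log (z₀ - c))) z₀ := by
      refine ContinuousAt.comp (g := κ) (hκc.continuousAt (hHo.mem_nhds ?_)) hlog
      refine hmem z₀ _ hz₀ ?_
      simp [div_self hz₀', Complex.exp_log hz₀']
    refine (h1.congr ?_).continuousWithinAt
    have : {z | R < ‖z - c‖} ∈ 𝓝 z₀ :=
      (isOpen_lt continuous_const (by fun_prop)).mem_nhds hz₀
    filter_upwards [this] with z hz
    have hz' := hne z hz
    apply hκe
    rw [Complex.exp_add, Complex.exp_log (div_ne_zero hz' hz₀'), Complex.exp_log hz₀',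
      Complex.exp_log hz', div_mul_cancel₀ _ hz₀']
  · intro z hz
    have hz' := hne z hz
    have hl := hmem z _ hz (Complex.exp_log hz')
    have h1 := hθe _ hl
    rw [Complex.exp_log hz', add_sub_cancel] at h1
    simp only [hκ, indicator_of_mem hl]
    rw [Complex.exp_sub, ← h1, Complex.exp_int_mul, Complex.exp_log hz']
    field_simp

/-- A nowhere vanishing continuous function on an open subset of a circle is a power of the
coordinate up to an exponential. -/
theorem exists_zpow_mul_exp_of_sphere (c : ℂ) {r : ℝ} (hr : 0 < r) {K : Set ℂ} (hK : IsClosed K)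
    {u : ℂ → ℂ} (hu : ContinuousOn u (sphere c r \ K)) (h0 : ∀ z ∈ sphere c r \ K, u z ≠ 0) :
    ∃ (n : ℤ) (φ : ℂ → ℂ), ContinuousOn φ (sphere c r \ K) ∧
      ∀ z ∈ sphere c r \ K, u z = (z - c) ^ n * Complex.exp (φ z) := by
  by_cases hemp : ∃ x₀ ∈ sphere c r, x₀ ∈ K
  · obtain ⟨x₀, hx₀, hx₀K⟩ := hemp
    have hne : c - x₀ ≠ 0 := by
      rw [← norm_pos_iff, norm_sub_rev, ← dist_eq_norm, mem_sphere.1 hx₀]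
      exact hr
    set γ : ℝ → ℂ := fun t => c + (c - x₀) * Complex.exp (t * Complex.I) with hγ
    have hγc : Continuous γ := by fun_prop
    have hγs : ∀ t, γ t ∈ sphere c r := fun t => by
      rw [mem_sphere, dist_eq_norm] at *
      simp [hγ, Complex.norm_exp_ofReal_mul_I, norm_sub_rev c x₀, hx₀]
    obtain ⟨lam, h1, h2⟩ := exists_continuousOn_log_of_isOpen_real
      (W := γ ⁻¹' Kᶜ) (hK.isOpen_compl.preimage hγc) (f := u ∘ γ)
      (hu.comp hγc.continuousOn (fun t ht => ⟨hγs t, ht⟩)) (fun t ht => h0 _ ⟨hγs t, ht⟩)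
    have hγa : ∀ x ∈ sphere c r, γ (Complex.arg ((x - c) / (c - x₀))) = x := by
      intro x hx
      have hn : ‖(x - c) / (c - x₀)‖ = 1 := by
        rw [mem_sphere, dist_eq_norm] at *
        rw [norm_div, norm_sub_rev c x₀, hx, hx₀, div_self hr.ne']
      have := Complex.norm_mul_exp_arg_mul_I ((x - c) / (c - x₀))
      rw [hn, Complex.ofReal_one, one_mul] at this
      simp only [hγ, this]
      field_simp
      ring
    refine ⟨0, fun x => lam (Complex.arg ((x - c) / (c - x₀))), ?_, ?_⟩
    · have hA : ContinuousOn (fun x => Complex.arg ((x - c) / (c - x₀))) (sphere c r \ K) := by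
        intro x hx
        refine (ContinuousAt.comp (g := Complex.arg) (Complex.continuousAt_arg ?_)
          (by fun_prop)).continuousWithinAt
        rw [Complex.mem_slitPlane_iff_arg]
        have hxc : x - c ≠ 0 := by
          rw [← norm_pos_iff, ← dist_eq_norm, mem_sphere.1 hx.1]
          exact hr
        refine ⟨fun h => hx.2 ?_, div_ne_zero hxc hne⟩
        have := hγa x hx.1
        rw [h] at this
        simp only [hγ, Complex.exp_pi_mul_I] at this
        rw [← this]
        convert hx₀K using 1
        ring
      refine h1.comp hA ?_
      intro x hx
      simp only [mem_preimage, hγa x hx.1]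
      exact hx.2
    · intro x hx
      have := h2 (Complex.arg ((x - c) / (c - x₀))) (by
        simp only [mem_preimage, hγa x hx.1]
        exact hx.2)
      simpa [hγa x hx.1] using this
  · push Not at hemp
    have hs : sphere c r \ K = sphere c r := by
      ext x
      simpa using hemp x
    rw [hs] at hu h0 ⊢
    set ρ : ℂ → ℂ := fun z => c + (r / ‖z - c‖ : ℝ) * (z - c) with hρ
    have hρc : ContinuousOn ρ {z | 0 < ‖z - c‖} := by
      refine continuousOn_const.add (ContinuousOn.mul (Complex.continuous_ofReal.comp_continuousOn
        (continuousOn_const.div (by fun_prop) fun z hz => ne_of_gt hz)) (by fun_prop))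
    have hρs : ∀ z, 0 < ‖z - c‖ → ρ z ∈ sphere c r := fun z hz => by
      rw [mem_sphere, dist_eq_norm]
      have : |r| = r := abs_of_pos hr
      simp [hρ, this]
      field_simp
    obtain ⟨n, φ, hφ, he⟩ := exists_zpow_mul_exp_of_lt_norm c le_rfl (u := u ∘ ρ)
      (hu.comp hρc hρs) (fun z hz => h0 _ (hρs z hz))
    have hsub : ∀ z ∈ sphere c r, 0 < ‖z - c‖ := fun z hz => by
      rw [← dist_eq_norm, mem_sphere.1 hz]
      exact hr
    refine ⟨n, φ, hφ.mono hsub, fun z hz => ?_⟩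
    rw [← he z (hsub z hz)]
    have : ρ z = z := by
      simp only [hρ, ← dist_eq_norm, mem_sphere.1 hz, div_self hr.ne']
      simp
    simp [this]

/-- A nowhere vanishing continuous function on a closed disc has a continuous logarithm. -/
theorem exists_continuousOn_log_of_closedBall (c : ℂ) {r : ℝ} (hr : 0 < r) {u : ℂ → ℂ}
    (hu : ContinuousOn u (closedBall c r)) (h0 : ∀ z ∈ closedBall c r, u z ≠ 0) :
    ∃ φ : ℂ → ℂ, ContinuousOn φ (closedBall c r) ∧
      ∀ z ∈ closedBall c r, u z = Complex.exp (φ z) := by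
  set ρ : ℂ → ℂ := fun z => c + (r / max r ‖z - c‖ : ℝ) * (z - c) with hρ
  have hpos : ∀ z, 0 < max r ‖z - c‖ := fun z => lt_max_of_lt_left hr
  have hρc : Continuous ρ :=
    continuous_const.add ((Complex.continuous_ofReal.comp
      (continuous_const.div (by fun_prop) fun z => (hpos z).ne')).mul (by fun_prop))
  have hρs : ∀ z, ρ z ∈ closedBall c r := fun z => by
    rw [mem_closedBall, dist_eq_norm]
    simp only [hρ, add_sub_cancel_left, norm_mul, Complex.norm_real, Real.norm_eq_abs,
      abs_of_pos (div_pos hr (hpos z))]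
    rw [div_mul_eq_mul_div, div_le_iff₀ (hpos z)]
    gcongr
    exact le_max_right _ _
  obtain ⟨φ, h1, h2⟩ := exists_continuousOn_log_of_convex convex_univ isOpen_univ (f := u ∘ ρ)
    (hu.comp hρc.continuousOn fun z _ => hρs z) (fun z _ => h0 _ (hρs z))
  refine ⟨φ, h1.mono (subset_univ _), fun z hz => ?_⟩
  rw [← h2 z (mem_univ z)]
  have : ρ z = z := by
    rw [mem_closedBall, dist_eq_norm] at hz
    simp [hρ, max_eq_left hz, div_self (Complex.ofReal_ne_zero.2 hr.ne')]
  simp [this]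

theorem eventually_cobounded_iff {p : ℂ → Prop} :
    (∀ᶠ z in cobounded ℂ, p z) ↔ ∃ R : ℝ, 0 < R ∧ ∀ z, R < ‖z‖ → p z := by
  rw [← comap_norm_atTop, (atTop_basis_Ioi' (0 : ℝ)).comap _ |>.eventually_iff]
  simp

theorem eventually_cobounded_ne (c : ℂ) : ∀ᶠ z in cobounded ℂ, z ≠ c :=
  eventually_cobounded_iff.2 ⟨‖c‖ + 1, by positivity, fun z hz h => by
    subst h
    linarith⟩

/-- `u` is, near infinity, the `n`-th power of the coordinate times the exponential of a
continuous function: the winding number of `u` along large circles is `n`. -/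
def HasOrderAtInfty (u : ℂ → ℂ) (n : ℤ) : Prop :=
  ∃ φ : ℂ → ℂ, ∀ᶠ z in cobounded ℂ, ContinuousAt φ z ∧ u z = z ^ n * Complex.exp (φ z)

theorem exists_hasOrderAtInfty {u : ℂ → ℂ}
    (hu : ∀ᶠ z in cobounded ℂ, ContinuousAt u z ∧ u z ≠ 0) : ∃ n, HasOrderAtInfty u n := by
  obtain ⟨R, hR, h⟩ := eventually_cobounded_iff.1 hu
  obtain ⟨n, φ, hφ, he⟩ := exists_zpow_mul_exp_of_lt_norm 0 hR.le (u := u)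
    (fun z hz => (h z (by simpa using hz)).1.continuousWithinAt)
    (fun z hz => (h z (by simpa using hz)).2)
  refine ⟨n, φ, eventually_cobounded_iff.2 ⟨R, hR, fun z hz => ⟨?_, ?_⟩⟩⟩
  · refine hφ.continuousAt ((isOpen_lt continuous_const (by fun_prop)).mem_nhds ?_)
    simpa using hz
  · simpa using he z (by simpa using hz)

namespace HasOrderAtInfty

variable {u v g : ℂ → ℂ} {n m : ℤ}

theorem unique (h₁ : HasOrderAtInfty u n) (h₂ : HasOrderAtInfty u m) : n = m := by
  obtain ⟨φ, hφ⟩ := h₁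
  obtain ⟨ψ, hψ⟩ := h₂
  obtain ⟨R, hR, h⟩ := eventually_cobounded_iff.1 (hφ.and hψ)
  set γ : ℝ → ℂ := fun t => Complex.exp (Real.log (R + 1) + t * Complex.I) with hγ
  have hγn : ∀ t, R < ‖γ t‖ := fun t => by
    simp [hγ, Complex.norm_exp, Real.exp_log (show 0 < R + 1 by linarith)]
  have hγc : Continuous γ := by fun_prop
  set F : ℝ → ℂ := fun t =>
    (n - m) * (Real.log (R + 1) + t * Complex.I) + (φ (γ t) - ψ (γ t)) with hF
  have hFc : Continuous F := by
    refine Continuous.add (by fun_prop) (Continuous.sub ?_ ?_)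
    · exact continuous_iff_continuousAt.2 fun t =>
        ContinuousAt.comp (h _ (hγn t)).1.1 hγc.continuousAt
    · exact continuous_iff_continuousAt.2 fun t =>
        ContinuousAt.comp (h _ (hγn t)).2.1 hγc.continuousAt
  have hFe : ∀ t ∈ univ, Complex.exp (F t) = 1 := by
    intro t _
    have h1 := (h _ (hγn t)).1.2.symm.trans (h _ (hγn t)).2.2
    have h0 : γ t ≠ 0 := Complex.exp_ne_zero _
    have h2 : Complex.exp ((n - m) * (Real.log (R + 1) + t * Complex.I)) = γ t ^ n / γ t ^ m := by
      rw [← zpow_sub₀ h0, ← Int.cast_sub, Complex.exp_int_mul]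
    rw [hF]
    simp only [Complex.exp_add, Complex.exp_sub, h2]
    rw [div_mul_div_comm, h1, div_self]
    exact mul_ne_zero (zpow_ne_zero _ h0) (Complex.exp_ne_zero _)
  have := isPreconnected_univ.eq_of_exp_eq_const hFc.continuousOn hFe
    (mem_univ 0) (mem_univ (2 * Real.pi))
  have hγp : γ (2 * Real.pi) = γ 0 := by
    simp [hγ, Complex.exp_add]
  simp only [hF, hγp] at this
  have h3 : ((n : ℂ) - m) * (2 * Real.pi * Complex.I) = 0 := by
    push_cast at this
    linear_combination -this
  have h4 := (mul_eq_zero.1 h3).resolve_right Complex.two_pi_I_ne_zero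
  exact_mod_cast sub_eq_zero.1 h4

theorem congr (h : HasOrderAtInfty u n) (huv : u =ᶠ[cobounded ℂ] v) : HasOrderAtInfty v n := by
  obtain ⟨φ, hφ⟩ := h
  refine ⟨φ, ?_⟩
  filter_upwards [hφ, huv] with z h1 h2
  rwa [← h2]

theorem mul (h₁ : HasOrderAtInfty u n) (h₂ : HasOrderAtInfty v m) :
    HasOrderAtInfty (fun z => u z * v z) (n + m) := by
  obtain ⟨φ, hφ⟩ := h₁
  obtain ⟨ψ, hψ⟩ := h₂
  refine ⟨fun z => φ z + ψ z, ?_⟩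
  filter_upwards [hφ, hψ, eventually_cobounded_ne 0] with z h1 h2 h3
  refine ⟨h1.1.add h2.1, ?_⟩
  rw [h1.2, h2.2, zpow_add₀ h3, Complex.exp_add]
  ring

theorem zpow (h : HasOrderAtInfty u n) (k : ℤ) :
    HasOrderAtInfty (fun z => u z ^ k) (n * k) := by
  obtain ⟨φ, hφ⟩ := h
  refine ⟨fun z => k * φ z, ?_⟩
  filter_upwards [hφ] with z h1
  refine ⟨continuousAt_const.mul h1.1, ?_⟩
  rw [h1.2, mul_zpow, zpow_mul, Complex.exp_int_mul]

theorem exp {φ : ℂ → ℂ} (hφ : ∀ᶠ z in cobounded ℂ, ContinuousAt φ z) :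
    HasOrderAtInfty (fun z => Complex.exp (φ z)) 0 :=
  ⟨φ, hφ.mono fun z h => ⟨h, by simp⟩⟩

theorem of_tendsto {a : ℂ} (ha : a ≠ 0) (hu : ∀ᶠ z in cobounded ℂ, ContinuousAt u z)
    (ht : Tendsto u (cobounded ℂ) (𝓝 a)) : HasOrderAtInfty u 0 := by
  refine ⟨fun z => Complex.log (u z / a) + Complex.log a, ?_⟩
  have h1 : Tendsto (fun z => u z / a) (cobounded ℂ) (𝓝 1) := by
    simpa [div_self ha] using ht.div_const a
  filter_upwards [hu, h1.eventually (Complex.isOpen_slitPlane.mem_nhds Complex.one_mem_slitPlane)]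
    with z h2 h3
  refine ⟨((h2.div_const a).clog h3).add continuousAt_const, ?_⟩
  have := Complex.slitPlane_ne_zero h3
  rw [Complex.exp_add, Complex.exp_log this, Complex.exp_log ha, div_mul_cancel₀ _ ha]
  simp

theorem of_continuous (hu : Continuous u) (h0 : ∀ z, u z ≠ 0) : HasOrderAtInfty u 0 := by
  obtain ⟨φ, h1, h2⟩ := exists_continuousOn_log_of_convex convex_univ isOpen_univ
    hu.continuousOn fun z _ => h0 z
  exact ⟨φ, Eventually.of_forall fun z =>
    ⟨(continuousOn_univ.1 h1).continuousAt, by simpa using h2 z (mem_univ z)⟩⟩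

theorem comp (hu : HasOrderAtInfty u n) (hg : HasOrderAtInfty g m) (hgc : Continuous g)
    (ht : Tendsto g (cobounded ℂ) (cobounded ℂ)) : HasOrderAtInfty (u ∘ g) (n * m) := by
  obtain ⟨φ, hφ⟩ := hu
  obtain ⟨ψ, hψ⟩ := hg
  refine ⟨fun z => n * ψ z + φ (g z), ?_⟩
  filter_upwards [ht.eventually hφ, hψ] with z h1 h2
  refine ⟨(continuousAt_const.mul h2.1).add (ContinuousAt.comp h1.1 hgc.continuousAt), ?_⟩
  rw [Function.comp, h1.2, h2.2, mul_zpow, ← zpow_mul, Complex.exp_add, Complex.exp_int_mul,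
    ← h2.2, mul_comm m n]
  ring

theorem sub_const (c : ℂ) : HasOrderAtInfty (fun z => z - c) 1 := by
  have h1 : HasOrderAtInfty (fun z => z) 1 :=
    ⟨0, Eventually.of_forall fun z => ⟨continuousAt_const, by simp⟩⟩
  have h2 : HasOrderAtInfty (fun z => 1 - c * z⁻¹) 0 := by
    refine of_tendsto one_ne_zero ?_ ?_
    · filter_upwards [eventually_cobounded_ne 0] with z hz
      fun_prop (disch := exact hz)
    · simpa using (tendsto_const_nhds (x := (1 : ℂ))).sub
        ((tendsto_const_nhds (x := c)).mul (tendsto_inv₀_cobounded (α := ℂ)))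
  refine ((h1.mul h2).congr ?_)
  filter_upwards [eventually_cobounded_ne 0] with z hz
  field_simp

end HasOrderAtInfty

theorem tendsto_cobounded_of_iterate_three {g : ℂ → ℂ} (hg : Continuous g)
    (h3 : ∀ x, g (g (g x)) = x) : Tendsto g (cobounded ℂ) (cobounded ℂ) := by
  let e : ℂ ≃ₜ ℂ := ⟨⟨g, fun x => g (g x), h3, h3⟩, hg, hg.comp hg⟩
  rw [Metric.cobounded_eq_cocompact]
  exact e.isClosedEmbedding.tendsto_cocompact

theorem hasOrderAtInfty_of_iterate_three {g : ℂ → ℂ} (hg : Continuous g)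
    (h3 : ∀ x, g (g (g x)) = x) : HasOrderAtInfty g 1 := by
  have ht := tendsto_cobounded_of_iterate_three hg h3
  obtain ⟨m, hm⟩ := exists_hasOrderAtInfty (u := g)
    ((ht.eventually (eventually_cobounded_ne 0)).mono fun z hz => ⟨hg.continuousAt, hz⟩)
  have h1 : HasOrderAtInfty (g ∘ g ∘ g) (m * (m * m)) :=
    hm.comp (hm.comp hm hg ht) (hg.comp hg) (ht.comp ht)
  have h2 : HasOrderAtInfty (g ∘ g ∘ g) 1 :=
    (HasOrderAtInfty.sub_const 0).congr (Eventually.of_forall fun z => by simp [h3])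
  have h4 := h1.unique h2
  have h5 : m = 1 ∨ m = -1 := Int.isUnit_iff.1 (IsUnit.of_mul_eq_one _ h4)
  rcases h5 with rfl | rfl
  · exact hm
  · norm_num at h4

theorem ContinuousOn.continuousWithinAt_inter_of_isClosed {X Z : Type*} [TopologicalSpace X]
    [TopologicalSpace Z] {f : X → Z} {F Y : Set X} (hF : IsClosed F) (hf : ContinuousOn f (Y ∩ F))
    {x : X} (hx : x ∈ Y) : ContinuousWithinAt f (Y ∩ F) x := by
  by_cases h : x ∈ F
  · exact hf x ⟨hx, h⟩
  · exact continuousWithinAt_of_notMem_closure fun h' =>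
      h (hF.closure_subset_iff.2 inter_subset_right h')

/-- Removing the orbit of a disc from the bad set `K` of an invariant function, at the price of
changing its order at infinity by a multiple of three. -/
theorem exists_surgery {g : ℂ → ℂ} (hg : Continuous g) (h3 : ∀ x, g (g (g x)) = x)
    {c : ℂ} {r : ℝ} (hr : 0 < r)
    (hd : ∀ x ∈ closedBall c r, g x ∉ closedBall c r ∧ g (g x) ∉ closedBall c r)
    {K : Set ℂ} (hK : IsClosed K) (hKg : ∀ x, g x ∈ K ↔ x ∈ K) {v : ℂ → ℂ} {n : ℤ}
    (hv : ContinuousOn v Kᶜ) (h0 : ∀ x ∉ K, v x ≠ 0) (hvg : ∀ x ∉ K, v (g x) = v x)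
    (hn : HasOrderAtInfty v n) :
    ∃ (K' : Set ℂ) (v' : ℂ → ℂ) (m : ℤ), IsClosed K' ∧ (∀ x, g x ∈ K' ↔ x ∈ K') ∧
      (∀ x ∈ K', x ∈ K ∧ ¬ (x ∈ ball c r ∨ g x ∈ ball c r ∨ g (g x) ∈ ball c r)) ∧
      ContinuousOn v' K'ᶜ ∧ (∀ x ∉ K', v' x ≠ 0) ∧ (∀ x ∉ K', v' (g x) = v' x) ∧
      HasOrderAtInfty v' (n - 3 * m) := by
  classical
  have ht := tendsto_cobounded_of_iterate_three hg h3
  have hbd : ∀ x ∈ ball c r, x ∈ closedBall c r := fun x hx => ball_subset_closedBall hx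
  set U : Set ℂ := {x | x ∈ ball c r ∨ g x ∈ ball c r ∨ g (g x) ∈ ball c r} with hU
  have hUo : IsOpen U := by
    have h1 := isOpen_ball (x := c) (ε := r)
    exact h1.union ((h1.preimage hg).union (h1.preimage (hg.comp hg)))
  have hUg : ∀ x, g x ∈ U ↔ x ∈ U := fun x => by
    simp only [hU, mem_ofPred_eq, h3]
    tauto
  have hSU : ∀ x ∈ sphere c r, x ∉ U := by
    rintro x hx (h | h | h)
    · rw [mem_sphere] at hx
      rw [mem_ball] at h
      exact h.ne hx
    · exact (hd x (sphere_subset_closedBall hx)).1 (hbd _ h)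
    · exact (hd x (sphere_subset_closedBall hx)).2 (hbd _ h)
  set N : ℂ → ℂ := fun x => (x - c) * (g x - c) * (g (g x) - c) with hN
  have hNg : ∀ x, N (g x) = N x := fun x => by
    simp only [hN, h3]
    ring
  have hNc : Continuous N := by fun_prop
  have hcb : c ∈ ball c r := mem_ball_self hr
  have hN0 : ∀ x ∉ U, N x ≠ 0 := by
    intro x hx hx0
    simp only [hN, mul_eq_zero, sub_eq_zero] at hx0
    refine hx ?_
    rcases hx0 with (h | h) | h
    · exact Or.inl (h ▸ hcb)
    · exact Or.inr (Or.inl (h ▸ hcb))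
    · exact Or.inr (Or.inr (h ▸ hcb))
  have hcD : c ∈ closedBall c r := hbd c hcb
  obtain ⟨m, φ₀, hφ₀, he₀⟩ := exists_zpow_mul_exp_of_sphere c hr hK
    (hv.mono fun x hx => hx.2) (fun x hx => h0 x hx.2)
  obtain ⟨φ₁, hφ₁, he₁⟩ := exists_continuousOn_log_of_closedBall c hr (u := fun x => g x - c)
    (by fun_prop) (fun x hx h => (hd x hx).1 (by rwa [sub_eq_zero.1 h]))
  obtain ⟨φ₂, hφ₂, he₂⟩ := exists_continuousOn_log_of_closedBall c hr (u := fun x => g (g x) - c)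
    (by fun_prop) (fun x hx h => (hd x hx).2 (by rwa [sub_eq_zero.1 h]))
  set w : ℂ → ℂ := fun x => v x * N x ^ (-m) with hw
  have hSD : sphere c r \ K ⊆ closedBall c r := fun x hx => sphere_subset_closedBall hx.1
  have hwe : ∀ x ∈ sphere c r \ K, w x = Complex.exp (φ₀ x - m * φ₁ x - m * φ₂ x) := by
    intro x hx
    have hxc : x - c ≠ 0 := by
      rw [← norm_pos_iff, ← dist_eq_norm, mem_sphere.1 hx.1]
      exact hr
    simp only [hw, hN]
    rw [he₀ x hx, he₁ x (hSD hx), he₂ x (hSD hx), zpow_neg, mul_zpow, mul_zpow,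
      Complex.exp_sub, Complex.exp_sub, Complex.exp_int_mul, Complex.exp_int_mul]
    have := zpow_ne_zero m hxc
    have := zpow_ne_zero m (Complex.exp_ne_zero (φ₁ x))
    have := zpow_ne_zero m (Complex.exp_ne_zero (φ₂ x))
    field_simp
  set K' : Set ℂ := K \ U with hK'
  have hK'c : IsClosed K' := hK.sdiff hUo
  have hK'g : ∀ x, g x ∈ K' ↔ x ∈ K' := fun x => by
    simp only [hK', Set.mem_sdiff, hKg, hUg]
  obtain ⟨Φ, hΦ, hΦe⟩ := exists_continuousOn_extension (Y := K'ᶜ ∩ closedBall c r)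
    (A := sphere c r \ K) (fun x hx => ⟨fun h => hx.2 h.1, hSD hx⟩) isClosed_sphere
    (by
      ext x
      constructor
      · rintro ⟨⟨h1, -⟩, h2⟩
        exact ⟨h2, fun h => h1 ⟨h, hSU x h2⟩⟩
      · rintro ⟨h1, h2⟩
        exact ⟨⟨fun h => h2 h.1, sphere_subset_closedBall h1⟩, h1⟩)
    (φ := fun x => φ₀ x - m * φ₁ x - m * φ₂ x)
    ((hφ₀.sub (continuousOn_const.mul (hφ₁.mono hSD))).sub
      (continuousOn_const.mul (hφ₂.mono hSD)))
  set v' : ℂ → ℂ := fun x =>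
    if x ∈ ball c r then Complex.exp (Φ x)
    else if g x ∈ ball c r then Complex.exp (Φ (g x))
    else if g (g x) ∈ ball c r then Complex.exp (Φ (g (g x)))
    else w x with hv'
  have hv'U : ∀ x ∉ U, v' x = w x := by
    intro x hx
    simp only [hU, mem_ofPred_eq, not_or] at hx
    simp only [hv', if_neg hx.1, if_neg hx.2.1, if_neg hx.2.2]
  have hKU : ∀ x ∉ K', x ∉ U → x ∉ K := fun x h1 h2 h => h1 ⟨h, h2⟩
  have hwg : ∀ x ∉ K, w (g x) = w x := fun x hx => by
    simp only [hw, hNg, hvg x hx]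
  have hv'g : ∀ x ∉ K', v' (g x) = v' x := by
    intro x hx
    by_cases hxU : x ∈ U
    · simp only [hv', h3]
      by_cases h1 : x ∈ ball c r
      · have h2 : g x ∉ ball c r := fun h => (hd x (hbd x h1)).1 (hbd _ h)
        have h4 : g (g x) ∉ ball c r := fun h => (hd x (hbd x h1)).2 (hbd _ h)
        simp [h1, h2, h4]
      · by_cases h2 : g x ∈ ball c r
        · simp [h1, h2]
        · have h4 : g (g x) ∈ ball c r := (hxU.resolve_left h1).resolve_left h2
          simp [h1, h2, h4]
    · rw [hv'U _ hxU, hv'U _ (fun h => hxU ((hUg x).1 h)), hwg x (hKU x hx hxU)]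
  have hv'D : ∀ x ∈ K'ᶜ ∩ closedBall c r, v' x = Complex.exp (Φ x) := by
    rintro x ⟨hx, hxD⟩
    rcases (mem_closedBall.1 hxD).lt_or_eq with h | h
    · simp only [hv', if_pos (mem_ball.2 h)]
    · have hS : x ∈ sphere c r := h
      have hxA : x ∈ sphere c r \ K := ⟨hS, hKU x hx (hSU x hS)⟩
      rw [hv'U x (hSU x hS), hwe x hxA, hΦe hxA]
  have hc₀ : ContinuousOn v' (K'ᶜ ∩ closedBall c r) := hΦ.cexp.congr hv'D
  have hc₁ : ContinuousOn v' (K'ᶜ ∩ g ⁻¹' closedBall c r) := by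
    refine (hc₀.comp hg.continuousOn fun x hx => ⟨fun h => hx.1 ((hK'g x).1 h), hx.2⟩).congr ?_
    intro x hx
    exact (hv'g x hx.1).symm
  have hc₂ : ContinuousOn v' (K'ᶜ ∩ g ⁻¹' (g ⁻¹' closedBall c r)) := by
    refine (hc₁.comp hg.continuousOn fun x hx => ⟨fun h => hx.1 ((hK'g x).1 h), hx.2⟩).congr ?_
    intro x hx
    exact (hv'g x hx.1).symm
  have hc₃ : ContinuousOn v' (K'ᶜ ∩ Uᶜ) := by
    refine ContinuousOn.congr (f := w) ?_ fun x hx => hv'U x hx.2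
    refine (hv.mono fun x hx => hKU x hx.1 hx.2).mul (hNc.continuousOn.zpow₀ _ fun x hx => ?_)
    exact Or.inl (hN0 x hx.2)
  refine ⟨K', v', m, hK'c, hK'g, fun x hx => hx, ?_, ?_, hv'g, ?_⟩
  · intro x hx
    have hDc : IsClosed (closedBall c r) := isClosed_closedBall
    refine ((((hc₀.continuousWithinAt_inter_of_isClosed hDc hx).union
      (hc₁.continuousWithinAt_inter_of_isClosed (hDc.preimage hg) hx)).union
      (hc₂.continuousWithinAt_inter_of_isClosed ((hDc.preimage hg).preimage hg) hx)).union
      (hc₃.continuousWithinAt_inter_of_isClosed hUo.isClosed_compl hx)).mono ?_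
    intro y hy
    by_cases hyU : y ∈ U
    · rcases hyU with h | h | h
      · exact Or.inl (Or.inl (Or.inl ⟨hy, hbd _ h⟩))
      · exact Or.inl (Or.inl (Or.inr ⟨hy, hbd _ h⟩))
      · exact Or.inl (Or.inr ⟨hy, hbd _ h⟩)
    · exact Or.inr ⟨hy, hyU⟩
  · intro x hx
    by_cases hxU : x ∈ U
    · simp only [hv']
      split_ifs with h1 h2 h4
      · exact Complex.exp_ne_zero _
      · exact Complex.exp_ne_zero _
      · exact Complex.exp_ne_zero _
      · exact absurd hxU (not_or.2 ⟨h1, not_or.2 ⟨h2, h4⟩⟩)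
    · rw [hv'U x hxU]
      exact mul_ne_zero (h0 x (hKU x hx hxU)) (zpow_ne_zero _ (hN0 x hxU))
  · have hfar : ∀ᶠ z in cobounded ℂ, z ∉ ball c r := by
      have : (ball c r)ᶜ ∈ cobounded ℂ := isBounded_def.1 isBounded_ball
      exact this
    have hNo : HasOrderAtInfty N (1 + 1 * 1 + 1 * 1 * 1) := by
      have h1 := hasOrderAtInfty_of_iterate_three hg h3
      have h2 := HasOrderAtInfty.sub_const c
      exact (h2.mul (h2.comp h1 hg ht)).mul ((h2.comp h1 hg ht).comp h1 hg ht)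
    have := (hn.mul (hNo.zpow (-m))).congr (v := v') ?_
    · convert this using 1
      ring
    · filter_upwards [hfar, ht.eventually hfar, (ht.comp ht).eventually hfar] with z h1 h2 h4
      refine (hv'U z ?_).symm
      rintro (h | h | h)
      exacts [h1 h, h2 h, h4 h]

theorem three_dvd_of_finite_cover {g : ℂ → ℂ} (hg : Continuous g) (h3 : ∀ x, g (g (g x)) = x)
    (S : Finset (ℂ × ℝ))
    (hS : ∀ p ∈ S, 0 < p.2 ∧
      ∀ x ∈ closedBall p.1 p.2, g x ∉ closedBall p.1 p.2 ∧ g (g x) ∉ closedBall p.1 p.2)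
    {K : Set ℂ} (hK : IsClosed K) (hKg : ∀ x, g x ∈ K ↔ x ∈ K)
    (hKS : ∀ x ∈ K, ∃ p ∈ S, x ∈ ball p.1 p.2 ∨ g x ∈ ball p.1 p.2 ∨ g (g x) ∈ ball p.1 p.2)
    {v : ℂ → ℂ} {n : ℤ} (hv : ContinuousOn v Kᶜ) (h0 : ∀ x ∉ K, v x ≠ 0)
    (hvg : ∀ x ∉ K, v (g x) = v x) (hn : HasOrderAtInfty v n) : 3 ∣ n := by
  classical
  induction S using Finset.induction_on generalizing K v n with
  | empty =>
    have hemp : K = ∅ := eq_empty_of_forall_notMem fun x hx => by simpa using hKS x hx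
    subst hemp
    rw [compl_empty, continuousOn_univ] at hv
    rw [hn.unique (HasOrderAtInfty.of_continuous hv fun x => h0 x (notMem_empty x))]
    exact dvd_zero 3
  | insert p S hp ih =>
    obtain ⟨hr, hd⟩ := hS p (Finset.mem_insert_self p S)
    obtain ⟨K', v', m, h1, h2, h4, h5, h6, h7, h8⟩ :=
      exists_surgery hg h3 hr hd hK hKg hv h0 hvg hn
    have := ih (fun q hq => hS q (Finset.mem_insert_of_mem hq)) h1 h2 (fun x hx => by
      obtain ⟨q, hq, hq'⟩ := hKS x (h4 x hx).1
      rcases Finset.mem_insert.1 hq with rfl | hq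
      · exact absurd hq' (h4 x hx).2
      · exact ⟨q, hq, hq'⟩) h5 h6 h7 h8
    lia

/-- The order at infinity of a function which is invariant under a homeomorphism of order three,
and which is continuous and non-zero off a compact free set, is divisible by three. -/
theorem three_dvd_of_isCompact {g : ℂ → ℂ} (hg : Continuous g) (h3 : ∀ x, g (g (g x)) = x)
    {K : Set ℂ} (hK : IsCompact K) (hKg : ∀ x, g x ∈ K ↔ x ∈ K) (hfree : ∀ x ∈ K, g x ≠ x)
    {v : ℂ → ℂ} {n : ℤ} (hv : ContinuousOn v Kᶜ) (h0 : ∀ x ∉ K, v x ≠ 0)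
    (hvg : ∀ x ∉ K, v (g x) = v x) (hn : HasOrderAtInfty v n) : 3 ∣ n := by
  classical
  have key : ∀ x ∈ K, ∃ r : ℝ, 0 < r ∧
      ∀ y ∈ closedBall x r, g y ∉ closedBall x r ∧ g (g y) ∉ closedBall x r := by
    intro x hx
    have h1 := hfree x hx
    have h2 : g (g x) ≠ x := fun h => h1 (by rw [← h, h3, h])
    have hnear : ∀ h : ℂ → ℂ, Continuous h → h x ≠ x →
        ∀ᶠ r in 𝓝[>] (0 : ℝ), ∀ y ∈ closedBall x r, h y ∉ closedBall x r := by
      intro h hh hx'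
      have hdist : 0 < dist (h x) x := dist_pos.2 hx'
      have h4 : ∀ᶠ y in 𝓝 x, dist (h x) x / 2 < dist (h y) x :=
        (by fun_prop : ContinuousAt (fun y => dist (h y) x) x).eventually
          (lt_mem_nhds (by linarith))
      obtain ⟨ε, hε, hε'⟩ := Metric.eventually_nhds_iff.1 h4
      have h5 : ∀ᶠ r in 𝓝[>] (0 : ℝ), r < min ε (dist (h x) x / 2) :=
        nhdsWithin_le_nhds (gt_mem_nhds (lt_min hε (by linarith)))
      filter_upwards [h5] with r hr y hy hy'
      rw [mem_closedBall] at hy hy'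
      have := hε' (hy.trans_lt (hr.trans_le (min_le_left _ _)))
      have := hr.trans_le (min_le_right _ _)
      linarith
    obtain ⟨r, ⟨h4, h5⟩, h6⟩ := (((hnear g hg h1).and
      (hnear (fun y => g (g y)) (by fun_prop) h2)).and self_mem_nhdsWithin).exists
    exact ⟨r, h6, fun y hy => ⟨h4 y hy, h5 y hy⟩⟩
  choose! ρ hρ hρ' using key
  obtain ⟨t, ht, hKt⟩ := hK.elim_nhds_subcover (fun x => ball x (ρ x))
    fun x hx => ball_mem_nhds x (hρ x hx)
  refine three_dvd_of_finite_cover hg h3 (t.image fun x => (x, ρ x)) ?_ hK.isClosed hKg ?_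
    hv h0 hvg hn
  · intro p hp
    obtain ⟨x, hx, rfl⟩ := Finset.mem_image.1 hp
    exact ⟨hρ x (ht x hx), hρ' x (ht x hx)⟩
  · intro x hx
    obtain ⟨y, hy, hxy⟩ := mem_iUnion₂.1 (hKt hx)
    exact ⟨(y, ρ y), Finset.mem_image_of_mem _ hy, Or.inl hxy⟩

/-- A homeomorphism of order three of the plane is trivial if it preserves, near infinity, some
function of order one. -/
theorem eq_self_of_invariant_of_hasOrderAtInfty_one {g : ℂ → ℂ} (hg : Continuous g)
    (h3 : ∀ x, g (g (g x)) = x) {u : ℂ → ℂ} (hu : HasOrderAtInfty u 1)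
    (hug : ∀ᶠ z in cobounded ℂ, u (g z) = u z) (p : ℂ) : g p = p := by
  by_contra hp
  have ht := tendsto_cobounded_of_iterate_three hg h3
  obtain ⟨φ, hφ⟩ := hu.mul ((HasOrderAtInfty.sub_const p).zpow (-1))
  obtain ⟨R, hR, h⟩ := eventually_cobounded_iff.1 (hφ.and (eventually_cobounded_ne p))
  obtain ⟨Φ, hΦ, hΦe⟩ := exists_continuousOn_extension (Y := univ) (subset_univ _)
    (isClosed_le continuous_const continuous_norm : IsClosed {z : ℂ | R + 1 ≤ ‖z‖})
    (univ_inter _) (φ := φ) (fun z (hz : R + 1 ≤ ‖z‖) =>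
      (h z (by linarith)).1.1.continuousWithinAt)
  rw [continuousOn_univ] at hΦ
  set W : ℂ → ℂ := fun z => (z - p) * Complex.exp (Φ z) with hW
  have hWu : ∀ᶠ z in cobounded ℂ, W z = u z := by
    refine eventually_cobounded_iff.2 ⟨R + 1, by linarith, fun z hz => ?_⟩
    obtain ⟨⟨-, h1⟩, h2⟩ := h z (by linarith)
    simp only [hW]
    rw [hΦe hz.le]
    have h2 := sub_ne_zero.2 h2
    norm_num at h1
    rw [← h1]
    field_simp
  set v : ℂ → ℂ := fun z => W z + W (g z) + W (g (g z)) with hv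
  have hvc : Continuous v := by fun_prop
  have hvg : ∀ z, v (g z) = v z := fun z => by
    simp only [hv, h3]
    ring
  have hvu : ∀ᶠ z in cobounded ℂ, 3 * u z = v z := by
    filter_upwards [hWu, ht.eventually hWu, (ht.comp ht).eventually hWu, hug, ht.eventually hug]
      with z h1 h2 h4 h5 h6
    simp only [Function.comp] at h4
    simp only [hv, h1, h2, h4, h5, h6]
    ring
  have hvo : HasOrderAtInfty v 1 := by
    have := (HasOrderAtInfty.of_continuous (u := fun _ => 3) continuous_const (by norm_num)).mul hu
    exact (this.congr hvu)
  have hv0 : ∀ᶠ z in cobounded ℂ, v z ≠ 0 := by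
    obtain ⟨φ, hφ⟩ := hvo
    filter_upwards [hφ, eventually_cobounded_ne 0] with z h1 h2
    rw [h1.2]
    exact mul_ne_zero (zpow_ne_zero _ h2) (Complex.exp_ne_zero _)
  have hK : IsCompact {z | v z = 0} := by
    refine Metric.isCompact_of_isClosed_isBounded (isClosed_eq hvc continuous_const) ?_
    rw [isBounded_def]
    exact hv0
  have := three_dvd_of_isCompact hg h3 hK (fun x => by simp only [mem_ofPred_eq, hvg])
    (fun x hx hgx => ?_) hvc.continuousOn (fun x hx => hx) (fun x _ => hvg x) hvo
  · norm_num at this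
  · simp only [hv, mem_ofPred_eq, hgx, hW] at hx
    have h1 : 3 * ((x - p) * Complex.exp (Φ x)) = 0 := by linear_combination hx
    have h2 : x - p = 0 := by simpa [Complex.exp_ne_zero] using h1
    rw [sub_eq_zero] at h2
    exact hp (h2 ▸ hgx)

/-- A function which is changed by a finite group only through factors possessing continuous
logarithms can be corrected by an exponential to a semi-invariant function. -/
theorem exists_semiinvariant {X G : Type*} [TopologicalSpace X] [AddCommGroup G] [Fintype G]
    {act : G → X → X} (hact : ∀ g h x, act (g + h) x = act g (act h x))
    (hc : ∀ g, Continuous (act g)) {A : Set X} (hA : IsPreconnected A)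
    (hinv : ∀ g, ∀ x ∈ A, act g x ∈ A) {f : X → ℂ} (hf : ContinuousOn f A)
    (h0 : ∀ x ∈ A, f x ≠ 0) {φ : G → X → ℂ} (hφ : ∀ g, ContinuousOn (φ g) A)
    (he : ∀ g, ∀ x ∈ A, f (act g x) = f x * Complex.exp (φ g x)) :
    ∃ (ψ : X → ℂ) (χ : G → ℂ), ContinuousOn ψ A ∧ ∀ g, ∀ x ∈ A,
      f (act g x) * Complex.exp (ψ (act g x)) = χ g * (f x * Complex.exp (ψ x)) := by
  have hN : (Fintype.card G : ℂ) ≠ 0 := by exact_mod_cast Fintype.card_ne_zero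
  set ψ : X → ℂ := fun x => (∑ h, φ h x) / Fintype.card G with hψ
  have hψc : ContinuousOn ψ A := (continuousOn_finsetSum _ fun g _ => hφ g).div_const _
  set F : X → ℂ := fun x => f x * Complex.exp (ψ x) with hF
  have hFc : ContinuousOn F A := hf.mul hψc.cexp
  have hF0 : ∀ x ∈ A, F x ≠ 0 := fun x hx => mul_ne_zero (h0 x hx) (Complex.exp_ne_zero _)
  have hFp : ∀ x ∈ A, F x ^ Fintype.card G = ∏ h, f (act h x) := by
    intro x hx
    rw [Finset.prod_congr rfl fun h _ => he h x hx, Finset.prod_mul_distrib, ← Complex.exp_sum]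
    simp only [hF, hψ]
    rw [mul_pow, ← Complex.exp_nat_mul, mul_div_cancel₀ _ hN]
    simp
  have hFg : ∀ g, ∀ x ∈ A, F (act g x) ^ Fintype.card G = F x ^ Fintype.card G := by
    intro g x hx
    rw [hFp _ (hinv g x hx), hFp x hx]
    simp only [← hact]
    exact Fintype.prod_equiv (Equiv.addRight g) _ _ fun h => rfl
  rcases A.eq_empty_or_nonempty with rfl | ⟨a, ha⟩
  · exact ⟨ψ, 0, hψc, by simp⟩
  refine ⟨ψ, fun g => F (act g a) / F a, hψc, fun g x hx => ?_⟩
  have hconst : F (act g x) / F x = F (act g a) / F a := by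
    refine hA.eq_of_countable_image (φ := fun x => F (act g x) / F x)
      ((hFc.comp (hc g).continuousOn (hinv g)).div hFc hF0) ?_ hx ha
    refine ((Polynomial.nthRoots (Fintype.card G) (1 : ℂ)).toFinset.finite_toSet.countable).mono ?_
    rintro _ ⟨y, hy, rfl⟩
    rw [Finset.mem_coe, Multiset.mem_toFinset, Polynomial.mem_nthRoots Fintype.card_pos]
    simp only
    rw [div_pow, hFg g y hy, div_self (pow_ne_zero _ (hF0 y hy))]
  change F (act g x) = F (act g a) / F a * F x
  rw [← hconst, div_mul_cancel₀ _ (hF0 x hx)]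

theorem HasOrderAtInfty.mul_exp {u φ : ℂ → ℂ} {n : ℤ} (hu : HasOrderAtInfty u n)
    (hφ : ∀ᶠ z in cobounded ℂ, ContinuousAt φ z) :
    HasOrderAtInfty (fun z => u z * Complex.exp (φ z)) n := by
  simpa using hu.mul (HasOrderAtInfty.exp hφ)

theorem isPreconnected_setOf_lt_norm {R : ℝ} (hR : 0 ≤ R) :
    IsPreconnected {z : ℂ | R < ‖z‖} := by
  have hc : Convex ℝ {w : ℂ | R < Real.exp w.re} := by
    have : (Real.exp ⁻¹' Ioi R).OrdConnected :=
      ((isUpperSet_Ioi R).preimage Real.exp_monotone).ordConnected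
    exact this.convex.is_linear_preimage Complex.reLm.isLinear
  convert hc.isPreconnected.image Complex.exp Complex.continuous_exp.continuousOn using 1
  ext z
  constructor
  · intro hz
    have hz0 : z ≠ 0 := norm_pos_iff.1 (hR.trans_lt hz)
    refine ⟨Complex.log z, ?_, Complex.exp_log hz0⟩
    rwa [mem_ofPred_eq, ← Complex.norm_exp, Complex.exp_log hz0]
  · rintro ⟨w, hw, rfl⟩
    rwa [mem_ofPred_eq, Complex.norm_exp]

theorem add_three_smul_apply {X G : Type*} [AddCommGroup G] (hG : ∀ k : G, k + (k + k) = 0)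
    {act : G → X → X} (h0 : ∀ x, act 0 x = x)
    (hadd : ∀ k l x, act (k + l) x = act k (act l x)) (k : G) (x : X) :
    act k (act k (act k x)) = x := by
  rw [← hadd, ← hadd, add_assoc, hG, h0]

/-- An action of `ℤ/3` on the plane with two distinct fixed points is trivial. -/
theorem eq_self_of_two_fixed_points {act : ZMod 3 → ℂ → ℂ} (hc : ∀ k, Continuous (act k))
    (h0 : ∀ x, act 0 x = x) (hadd : ∀ k l x, act (k + l) x = act k (act l x)) {a c : ℂ}
    (hac : c ≠ a) (ha : ∀ k, act k a = a) (hfc : ∀ k, act k c = c) (k : ZMod 3) (x : ℂ) :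
    act k x = x := by
  have h3 := add_three_smul_apply (by decide) h0 hadd
  have hne : ∀ k, ∀ x ∈ ({a}ᶜ : Set ℂ), act k x ∈ ({a}ᶜ : Set ℂ) := by
    intro k x hx h
    rw [mem_singleton_iff] at h
    refine hx ?_
    rw [mem_singleton_iff, ← h3 k x, h, ha, ha]
  have hAo : IsOpen ({a}ᶜ : Set ℂ) := isOpen_compl_singleton
  have hset : {z : ℂ | 0 < ‖z - a‖} = {a}ᶜ := by
    ext z
    simp [sub_eq_zero]
  have hfar : ∀ φ : ℂ → ℂ, ContinuousOn φ {a}ᶜ → ∀ᶠ z in cobounded ℂ, ContinuousAt φ z := by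
    intro φ hφ
    filter_upwards [eventually_cobounded_ne a] with z hz
    exact hφ.continuousAt (hAo.mem_nhds hz)
  have hlog : ∀ k, ∃ φ : ℂ → ℂ, ContinuousOn φ {a}ᶜ ∧
      ∀ x ∈ ({a}ᶜ : Set ℂ), act k x - a = (x - a) * Complex.exp (φ x) := by
    intro k
    have hk := hc k
    have hcont : ContinuousOn (fun x => (act k x - a) * (x - a) ^ (-1 : ℤ)) {a}ᶜ := by
      refine ContinuousOn.mul (by fun_prop) (ContinuousOn.zpow₀ (by fun_prop) _ fun x hx => ?_)
      exact Or.inl (sub_ne_zero.2 hx)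
    obtain ⟨m, φ, hφ, he⟩ := exists_zpow_mul_exp_of_lt_norm a le_rfl
      (u := fun x => (act k x - a) * (x - a) ^ (-1 : ℤ)) (by rwa [hset])
      (fun z hz => by
        have hz : z ∈ ({a}ᶜ : Set ℂ) := hset ▸ hz
        exact mul_ne_zero (sub_ne_zero.2 (hne k z hz)) (zpow_ne_zero _ (sub_ne_zero.2 hz)))
    rw [hset] at hφ
    have hs := HasOrderAtInfty.sub_const a
    have h1 := (hs.comp (hasOrderAtInfty_of_iterate_three hk (h3 k)) hk
      (tendsto_cobounded_of_iterate_three hk (h3 k))).mul (hs.zpow (-1))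
    have h2 := ((hs.zpow m).mul_exp (hfar φ hφ)).congr (v := fun x =>
      ((fun z => z - a) ∘ act k) x * (x - a) ^ (-1 : ℤ)) (by
        filter_upwards [eventually_cobounded_ne a] with z hz
        exact (he z (by simpa [sub_eq_zero] using hz)).symm)
    have hm := h1.unique h2
    norm_num at hm
    subst hm
    refine ⟨φ, hφ, fun x hx => ?_⟩
    have hx' := sub_ne_zero.2 hx
    have := he x (by simpa [sub_eq_zero] using hx)
    rw [zpow_zero, one_mul] at this
    rw [← this]
    simp only [zpow_neg, zpow_one]
    field_simp
  choose φ hφ he using hlog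
  have hA : IsPreconnected ({a}ᶜ : Set ℂ) :=
    (isConnected_compl_singleton_of_one_lt_rank (by simp) a).isPreconnected
  obtain ⟨ψ, χ, hψ, hχ⟩ := exists_semiinvariant hadd hc hA hne (f := fun x => x - a)
    (by fun_prop) (fun x hx => sub_ne_zero.2 hx) hφ he
  have hχ1 : χ k = 1 := by
    have := hχ k c hac
    simp only [hfc] at this
    exact (mul_eq_right₀ (mul_ne_zero (sub_ne_zero.2 hac) (Complex.exp_ne_zero _))).1 this.symm
  refine eq_self_of_invariant_of_hasOrderAtInfty_one (hc k) (h3 k)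
    ((HasOrderAtInfty.sub_const a).mul_exp (hfar ψ hψ)) ?_ x
  filter_upwards [eventually_cobounded_ne a] with z hz
  rw [hχ k z hz, hχ1, one_mul]

/-- An action of `ℤ/3 × ℤ/3` on the plane is not faithful. -/
theorem exists_ne_zero_forall_eq_self {act : ZMod 3 × ZMod 3 → ℂ → ℂ}
    (hc : ∀ k, Continuous (act k)) (h0 : ∀ x, act 0 x = x)
    (hadd : ∀ k l x, act (k + l) x = act k (act l x)) : ∃ k ≠ 0, ∀ x, act k x = x := by
  have h3 := add_three_smul_apply (by decide) h0 hadd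
  have ht := fun k => tendsto_cobounded_of_iterate_three (hc k) (h3 k)
  have hord := fun k => hasOrderAtInfty_of_iterate_three (hc k) (h3 k)
  choose φ hφ using hord
  obtain ⟨R, hR, hφR⟩ := eventually_cobounded_iff.1 (eventually_all.2 hφ)
  have hlt : ∀ S : ℝ, ∀ᶠ z in cobounded ℂ, ∀ k, S < ‖act k z‖ := fun S =>
    eventually_all.2 fun k => (tendsto_norm_cobounded_atTop.comp (ht k)).eventually_gt_atTop S
  obtain ⟨R', hR', hRR'⟩ := eventually_cobounded_iff.1 (hlt R)
  set B : Set ℂ := {z | R' < ‖z‖} with hB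
  set A : Set ℂ := ⋃ k, act k '' B with hA
  have hBA : B ⊆ A := fun z hz => mem_iUnion.2 ⟨0, z, hz, h0 z⟩
  have hAR : ∀ z ∈ A, R < ‖z‖ := by
    intro z hz
    obtain ⟨k, y, hy, rfl⟩ := mem_iUnion.1 hz
    exact hRR' y hy k
  have hinv : ∀ k, ∀ x ∈ A, act k x ∈ A := by
    intro k x hx
    obtain ⟨l, y, hy, rfl⟩ := mem_iUnion.1 hx
    exact mem_iUnion.2 ⟨k + l, y, hy, hadd k l y⟩
  obtain ⟨z₀, hz₀⟩ := (hlt R').exists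
  have hz₀B : z₀ ∈ B := by
    have := hz₀ 0
    rwa [h0] at this
  have hconn : IsPreconnected A := by
    refine isPreconnected_iUnion ⟨z₀, mem_iInter.2 fun k => ⟨act (-k) z₀, hz₀ (-k), ?_⟩⟩ fun k =>
      (isPreconnected_setOf_lt_norm hR'.le).image _ (hc k).continuousOn
    rw [← hadd, add_neg_cancel, h0]
  have hA0 : ∀ z ∈ A, z ≠ 0 := fun z hz => norm_pos_iff.1 (hR.trans (hAR z hz))
  obtain ⟨ψ, χ, hψ, hχ⟩ := exists_semiinvariant hadd hc hconn hinv (f := fun x => x)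
    continuousOn_id hA0 (φ := φ)
    (fun k x hx => (hφR x (hAR x hx) k).1.continuousWithinAt)
    (fun k x hx => by simpa using (hφR x (hAR x hx) k).2)
  have hF0 : z₀ * Complex.exp (ψ z₀) ≠ 0 :=
    mul_ne_zero (hA0 z₀ (hBA hz₀B)) (Complex.exp_ne_zero _)
  have hχadd : ∀ k l, χ (k + l) = χ k * χ l := by
    intro k l
    have h1 := hχ (k + l) z₀ (hBA hz₀B)
    rw [hadd, hχ k _ (hinv l _ (hBA hz₀B)), hχ l _ (hBA hz₀B), ← mul_assoc] at h1
    exact (mul_right_cancel₀ hF0 h1).symm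
  have hχ0 : χ 0 = 1 := by
    have h1 := hχ 0 z₀ (hBA hz₀B)
    rw [h0] at h1
    exact (mul_eq_right₀ hF0).1 h1.symm
  have hχ3 : ∀ k, χ k ^ 3 = 1 := by
    intro k
    have : k + (k + k) = 0 := by
      revert k
      decide
    rw [← hχ0, ← this, hχadd, hχadd]
    ring
  obtain ⟨k, -, l, -, hkl, hχkl⟩ := Finset.exists_ne_map_eq_of_card_lt_of_maps_to
    (s := (Finset.univ : Finset (ZMod 3 × ZMod 3)))
    (t := (Polynomial.nthRoots 3 (1 : ℂ)).toFinset) (f := χ) (by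
      refine ((Multiset.toFinset_card_le _).trans (Polynomial.card_nthRoots 3 1)).trans_lt ?_
      decide) (by
      intro k _
      simpa [Polynomial.mem_nthRoots] using hχ3 k)
  have hχ1 : χ (k - l) = 1 := by
    have hl : χ l ≠ 0 := fun h => by simpa [h] using hχ3 l
    have := hχadd (k - l) l
    rw [sub_add_cancel, hχkl] at this
    exact (mul_eq_right₀ hl).1 this.symm
  refine ⟨k - l, sub_ne_zero.2 hkl, ?_⟩
  have hBo : IsOpen B := isOpen_lt continuous_const continuous_norm
  have hBf : ∀ᶠ z in cobounded ℂ, z ∈ B := eventually_cobounded_iff.2 ⟨R', hR', fun z hz => hz⟩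
  refine eq_self_of_invariant_of_hasOrderAtInfty_one (hc _) (h3 _)
    ((HasOrderAtInfty.sub_const 0).mul_exp (φ := ψ) ?_) ?_
  · filter_upwards [hBf] with z hz
    exact hψ.continuousAt (mem_of_superset (hBo.mem_nhds hz) hBA)
  · filter_upwards [hBf] with z hz
    have := hχ (k - l) z (hBA hz)
    simpa only [sub_zero, hχ1, one_mul] using this

section Chart

variable {X : Type*} [TopologicalSpace X] {b : X} {e : OpenPartialHomeomorph X ℂ}

theorem chart_symm_ne (hs : e.source = {b}ᶜ) (ht : e.target = univ) (z : ℂ) : e.symm z ≠ b := by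
  have := e.map_target (x := z) (ht ▸ mem_univ z)
  rwa [hs] at this

theorem chart_apply_symm (ht : e.target = univ) (z : ℂ) : e (e.symm z) = z :=
  e.right_inv (ht ▸ mem_univ z)

theorem chart_symm_apply (hs : e.source = {b}ᶜ) {x : X} (hx : x ≠ b) : e.symm (e x) = x :=
  e.left_inv (hs ▸ hx)

theorem eq_of_chart_eq (hs : e.source = {b}ᶜ) {x y : X} (hx : x ≠ b) (hy : y ≠ b)
    (h : e x = e y) : x = y :=
  e.injOn (hs ▸ hx) (hs ▸ hy) h

theorem continuous_chart_symm (ht : e.target = univ) : Continuous e.symm := by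
  rw [← continuousOn_univ, ← ht]
  exact e.continuousOn_symm

theorem continuousAt_chart (hs : e.source = {b}ᶜ) {x : X} (hx : x ≠ b) :
    ContinuousAt e x :=
  e.continuousAt (hs ▸ hx)

theorem tendsto_chart_cobounded [T2Space X] (hs : e.source = {b}ᶜ) (ht : e.target = univ) :
    Tendsto e (𝓝[≠] b) (cobounded ℂ) := by
  rw [Metric.cobounded_eq_cocompact, (hasBasis_cocompact).tendsto_right_iff]
  intro C hC
  have h1 := (hC.image (continuous_chart_symm ht)).isClosed.isOpen_compl.mem_nhds (x := b) (by
    rintro ⟨z, -, hz⟩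
    exact chart_symm_ne hs ht z hz)
  filter_upwards [mem_nhdsWithin_of_mem_nhds h1, self_mem_nhdsWithin] with x hx hxb hxC
  exact hx ⟨e x, hxC, chart_symm_apply hs hxb⟩

theorem tendsto_chart_symm_nhds [CompactSpace X] [T2Space X] (hs : e.source = {b}ᶜ)
    (ht : e.target = univ) : Tendsto e.symm (cobounded ℂ) (𝓝 b) := by
  rw [Metric.cobounded_eq_cocompact, (nhds_basis_opens b).tendsto_right_iff]
  rintro U ⟨hbU, hU⟩
  have hsub : Uᶜ ⊆ e.source := fun x hx => by
    rw [hs]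
    rintro rfl
    exact hx hbU
  have := (hU.isClosed_compl.isCompact.image_of_continuousOn
    (e.continuousOn.mono hsub)).compl_mem_cocompact
  filter_upwards [this] with z hz
  by_contra hzU
  exact hz ⟨e.symm z, hzU, chart_apply_symm ht z⟩

/-- An action fixing `b` restricts to the plane `{b}ᶜ`. -/
theorem exists_plane_action {G : Type*} [AddCommGroup G] (hs : e.source = {b}ᶜ)
    (ht : e.target = univ) {act : G → X → X} (hc : ∀ k, Continuous (act k))
    (h0 : ∀ x, act 0 x = x) (hadd : ∀ k l x, act (k + l) x = act k (act l x))
    (hb : ∀ k, act k b = b) :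
    ∃ act' : G → ℂ → ℂ, (∀ k, Continuous (act' k)) ∧ (∀ z, act' 0 z = z) ∧
      (∀ k l z, act' (k + l) z = act' k (act' l z)) ∧
      ∀ k z, e.symm (act' k z) = act k (e.symm z) := by
  have hne : ∀ k, ∀ x ≠ b, act k x ≠ b := by
    intro k x hx h
    refine hx ?_
    rw [← h0 x, ← neg_add_cancel k, hadd, h, hb]
  have hne' := fun k z => hne k _ (chart_symm_ne hs ht z)
  have hsymm : ∀ k z, e.symm (e (act k (e.symm z))) = act k (e.symm z) := fun k z =>
    chart_symm_apply hs (hne' k z)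
  refine ⟨fun k z => e (act k (e.symm z)), fun k => ?_, fun z => ?_, fun k l z => ?_, hsymm⟩
  · exact continuous_iff_continuousAt.2 fun z =>
      ContinuousAt.comp (f := fun z => act k (e.symm z)) (continuousAt_chart hs (hne' k z))
        ((hc k).comp (continuous_chart_symm ht)).continuousAt
  · simp only [h0, chart_apply_symm ht]
  · simp only [hsymm, hadd]

theorem continuous_inv_chart_sub [T2Space X] [DecidableEq X] (hs : e.source = {b}ᶜ)
    (ht : e.target = univ) {f : ℂ → X} (hf : Continuous f) (hne : ∀ z, f z ≠ e.symm z) :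
    Continuous fun z => if f z = b then 0 else (e (f z) - z)⁻¹ := by
  have hsub : ∀ z, f z ≠ b → e (f z) - z ≠ 0 := by
    intro z hz h
    refine hne z ?_
    rw [← chart_symm_apply hs hz, sub_eq_zero.1 h]
  rw [continuous_iff_continuousAt]
  intro z
  by_cases hz : f z = b
  · rw [ContinuousAt, if_pos hz]
    have h1 : Tendsto (fun p : X × ℂ => if p.1 = b then 0 else (e p.1 - p.2)⁻¹)
        (𝓝 (b, z)) (𝓝 (0 : ℂ)) := by
      have h2 : Tendsto (fun p : X × ℂ => (e p.1 - p.2)⁻¹) (𝓝[≠] b ×ˢ 𝓝 z) (𝓝 0) := by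
        refine tendsto_inv₀_cobounded.comp ?_
        rw [← tendsto_norm_atTop_iff_cobounded]
        have h4 : Tendsto (fun p : X × ℂ => ‖e p.1‖) (𝓝[≠] b ×ˢ 𝓝 z) atTop :=
          (tendsto_norm_cobounded_atTop.comp (tendsto_chart_cobounded hs ht)).comp tendsto_fst
        have h5 : Tendsto (fun p : X × ℂ => -‖p.2‖) (𝓝[≠] b ×ˢ 𝓝 z) (𝓝 (-‖z‖)) :=
          (tendsto_snd (f := 𝓝[≠] b) (g := 𝓝 z)).norm.neg
        refine tendsto_atTop_mono (fun p => ?_) (h4.atTop_add h5)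
        have := norm_sub_norm_le (e p.1) p.2
        linarith
      rw [nhds_prod_eq, ← nhdsNE_sup_pure b, sup_prod]
      refine Tendsto.sup ?_ ?_
      · refine h2.congr' ?_
        have : ∀ᶠ p : X × ℂ in 𝓝[≠] b ×ˢ 𝓝 z, p.1 ≠ b :=
          tendsto_fst.eventually (self_mem_nhdsWithin : {b}ᶜ ∈ 𝓝[≠] b)
        filter_upwards [this] with p hp
        rw [if_neg hp]
      · refine tendsto_const_nhds.congr' ?_
        have : ∀ᶠ p : X × ℂ in pure b ×ˢ 𝓝 z, p.1 = b :=
          tendsto_fst.eventually (by simp : ∀ᶠ x in pure b, x = b)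
        filter_upwards [this] with p hp
        rw [if_pos hp]
    have h6 : Tendsto (fun z => (f z, z)) (𝓝 z) (𝓝 (b, z)) := by
      rw [← hz]
      exact (hf.prodMk continuous_id).continuousAt
    exact h1.comp h6
  · have h1 : ContinuousAt (fun z => (e (f z) - z)⁻¹) z :=
      ((((continuousAt_chart hs hz).comp hf.continuousAt)).sub continuousAt_id).inv₀ (hsub z hz)
    refine h1.congr ?_
    filter_upwards [hf.continuousAt.eventually_ne hz] with y hy
    rw [if_neg hy]

/-- A homeomorphism of order three of the sphere has a fixed point. -/
theorem exists_fixed_point_of_iterate_three [CompactSpace X] [T2Space X] (hs : e.source = {b}ᶜ)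
    (ht : e.target = univ) {g : X → X} (hg : Continuous g) (h3 : ∀ x, g (g (g x)) = x) :
    ∃ x, g x = x := by
  classical
  by_contra! hfix
  have hfix2 : ∀ x, g (g x) ≠ x := fun x h => hfix x (by rw [← h, h3, h])
  have hσ := continuous_chart_symm ht
  have hinf : Tendsto e.symm (cobounded ℂ) (𝓝 b) := tendsto_chart_symm_nhds hs ht
  set J : (X → X) → ℂ → ℂ := fun f z =>
    if f (e.symm z) = b then 0 else (e (f (e.symm z)) - z)⁻¹ with hJ
  have hJc : ∀ f : X → X, Continuous f → (∀ x, f x ≠ x) → Continuous (J f) := fun f hf hne =>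
    continuous_inv_chart_sub hs ht (hf.comp hσ) fun z => hne _
  have hsub : ∀ f : X → X, (∀ x, f x ≠ x) → ∀ z, f (e.symm z) ≠ b →
      e (f (e.symm z)) - z ≠ 0 := by
    intro f hf z hz h
    refine hf (e.symm z) ?_
    rw [← chart_symm_apply hs hz, sub_eq_zero.1 h]
  have hlim : ∀ f : X → X, Continuous f → (∀ x, f x ≠ x) →
      Tendsto (fun z => e (f (e.symm z))) (cobounded ℂ) (𝓝 (e (f b))) ∧
      (∀ᶠ z in cobounded ℂ, f (e.symm z) ≠ b) ∧
      Tendsto (fun z => z * J f z) (cobounded ℂ) (𝓝 (-1)) := by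
    intro f hf hne
    have h1 : Tendsto (fun z => f (e.symm z)) (cobounded ℂ) (𝓝 (f b)) :=
      (hf.tendsto b).comp hinf
    have h2 : Tendsto (fun z => e (f (e.symm z))) (cobounded ℂ) (𝓝 (e (f b))) :=
      (continuousAt_chart hs (hne b)).tendsto.comp h1
    have h4 := h1.eventually_ne (hne b)
    refine ⟨h2, h4, ?_⟩
    have h5 : Tendsto (fun z => (e (f (e.symm z)) * z⁻¹ - 1)⁻¹) (cobounded ℂ) (𝓝 (-1)) := by
      have := ((h2.mul (tendsto_inv₀_cobounded (α := ℂ))).sub_const 1).inv₀ (by simp)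
      convert this using 2
      norm_num
    refine h5.congr' ?_
    filter_upwards [h4, eventually_cobounded_ne 0] with z hz hz0
    have := hsub f hne z hz
    simp only [hJ, if_neg hz]
    field_simp
  obtain ⟨a1, a2, a3⟩ := hlim g hg hfix
  obtain ⟨b1, b2, b3⟩ := hlim (fun x => g (g x)) (hg.comp hg) hfix2
  set t : ℂ → ℂ := fun z => J g z - J (fun x => g (g x)) z with htdef
  have htc : Continuous t := (hJc g hg hfix).sub (hJc _ (hg.comp hg) hfix2)
  have ht0 : ∀ z, t z ≠ 0 := by
    intro z hz
    have h1 := sub_eq_zero.1 hz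
    simp only [hJ] at h1
    have hd : g (g (e.symm z)) ≠ g (e.symm z) := hfix _
    split_ifs at h1 with h4 h5 h5
    · exact hd (h5.trans h4.symm)
    · exact inv_ne_zero (hsub (fun x => g (g x)) hfix2 z h5) h1.symm
    · exact inv_ne_zero (hsub g hfix z h4) h1
    · have h6 := sub_left_injective (inv_injective h1)
      exact hd (eq_of_chart_eq hs h5 h4 h6.symm)
  have hq : e (g (g b)) - e (g b) ≠ 0 := fun h =>
    hfix (g b) (eq_of_chart_eq hs (hfix2 b) (hfix b) (sub_eq_zero.1 h))
  have hlim2 : Tendsto (fun z => (z - 0) ^ (2 : ℤ) * t z) (cobounded ℂ)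
      (𝓝 (e (g (g b)) - e (g b))) := by
    have h1 := (b1.sub a1).mul (a3.mul b3)
    rw [neg_one_mul, neg_neg, mul_one] at h1
    refine h1.congr' ?_
    filter_upwards [a2, b2] with z hz hz'
    have := hsub g hfix z hz
    have := hsub (fun x => g (g x)) hfix2 z hz'
    simp only [htdef, hJ, if_neg hz, if_neg hz', sub_zero, zpow_ofNat]
    field_simp
    ring
  have ho1 : HasOrderAtInfty (fun z => (z - 0) ^ (2 : ℤ) * t z) 0 :=
    HasOrderAtInfty.of_tendsto hq (Eventually.of_forall fun z => by
      simp only [zpow_ofNat]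
      fun_prop) hlim2
  have ho2 := ((HasOrderAtInfty.sub_const 0).zpow 2).mul (HasOrderAtInfty.of_continuous htc ht0)
  have := ho1.unique ho2
  norm_num at this

/-- An action of `ℤ/3` on the sphere with three distinct fixed points is trivial. -/
theorem eq_self_of_three_fixed_points (hs : e.source = {b}ᶜ) (ht : e.target = univ)
    {act : ZMod 3 → X → X} (hc : ∀ k, Continuous (act k)) (h0 : ∀ x, act 0 x = x)
    (hadd : ∀ k l x, act (k + l) x = act k (act l x)) {a c : X} (hab : a ≠ b) (hcb : c ≠ b)
    (hca : c ≠ a) (hb : ∀ k, act k b = b) (ha : ∀ k, act k a = a) (hfc : ∀ k, act k c = c)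
    (k : ZMod 3) (x : X) : act k x = x := by
  obtain ⟨act', h1, h2, h4, h5⟩ := exists_plane_action hs ht hc h0 hadd hb
  have hfix : ∀ y ≠ b, ∀ k, act k y = y → act' k (e y) = e y := by
    intro y hy k hk
    rw [← chart_apply_symm ht (act' k (e y)), h5, chart_symm_apply hs hy, hk]
  have hne : e c ≠ e a := fun h => hca (eq_of_chart_eq hs hcb hab h)
  have key := eq_self_of_two_fixed_points h1 h2 h4 hne (fun k => hfix a hab k (ha k))
    (fun k => hfix c hcb k (hfc k)) k
  by_cases hx : x = b
  · rw [hx, hb]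
  · rw [← chart_symm_apply hs hx, ← h5, key]

end Chart

/-- The sphere punctured at `b` is a plane. -/
theorem exists_chart_sphere (b : sphere (0 : EuclideanSpace ℝ (Fin 3)) 1) :
    ∃ e : OpenPartialHomeomorph (sphere (0 : EuclideanSpace ℝ (Fin 3)) 1) ℂ,
      e.source = {b}ᶜ ∧ e.target = univ := by
  have : Fact (Module.finrank ℝ (EuclideanSpace ℝ (Fin 3)) = 2 + 1) := ⟨by simp⟩
  refine ⟨(stereographic' 2 b).transHomeomorph
    Complex.orthonormalBasisOneI.repr.symm.toHomeomorph, ?_, ?_⟩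
  · simp
  · simp

/-- No effective (faithful) action of `ℤ/3 × ℤ/3` on the 2-sphere by homeomorphisms: there
is no additive action of `ZMod 3 × ZMod 3` on `S² ⊆ ℝ³` by continuous maps (equivalently,
by homeomorphisms, since each `act g` has continuous inverse `act (-g)`) such that only the
identity element acts as the identity map; i.e. no such action with `act` injective. -/
theorem no_effective_Z3Z3_action_on_S2 :
    ¬ ∃ act : ZMod 3 × ZMod 3 →
        (Metric.sphere (0 : EuclideanSpace ℝ (Fin 3)) 1 →
          Metric.sphere (0 : EuclideanSpace ℝ (Fin 3)) 1),
      (∀ g, Continuous (act g)) ∧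
      act 0 = id ∧
      (∀ g h, act (g + h) = act g ∘ act h) ∧
      Function.Injective act := by
  rintro ⟨act, hc, h0', hadd', hinj⟩
  have h0 : ∀ x, act 0 x = x := fun x => congrFun h0' x
  have hadd : ∀ k l x, act (k + l) x = act k (act l x) := fun k l x => congrFun (hadd' k l) x
  have hfaith : ∀ k, (∀ x, act k x = x) → k = 0 := fun k hk =>
    hinj (funext fun x => (hk x).trans (h0 x).symm)
  have h3 := add_three_smul_apply (by decide) h0 hadd
  have hnsmul : ∀ k x, act k x = x → ∀ n : ℕ, act (n • k) x = x := by
    intro k x hk n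
    induction n with
    | zero => rw [zero_smul, h0]
    | succ n ih => rw [add_smul, one_smul, hadd, hk, ih]
  obtain ⟨p, -⟩ : (univ : Set (sphere (0 : EuclideanSpace ℝ (Fin 3)) 1)).Nonempty :=
    ⟨⟨EuclideanSpace.single 0 1, by simp⟩, mem_univ _⟩
  obtain ⟨e₀, hs₀, ht₀⟩ := exists_chart_sphere p
  obtain ⟨b, hb⟩ := exists_fixed_point_of_iterate_three hs₀ ht₀ (hc (1, 0)) (h3 (1, 0))
  obtain ⟨e, hs, ht⟩ := exists_chart_sphere b
  have hcomm : ∀ x, act (1, 0) x = x → act (1, 0) (act (0, 1) x) = act (0, 1) x := by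
    intro x hx
    rw [← hadd, add_comm, hadd, hx]
  have hhb : act (0, 1) b = b := by
    by_contra hne
    have h31 := h3 (0, 1) b
    have hne2 : act (0, 1) (act (0, 1) b) ≠ b := fun h => hne (by rwa [h] at h31)
    have hne3 : act (0, 1) (act (0, 1) b) ≠ act (0, 1) b := fun h => hne (by rwa [h, h] at h31)
    have hpow : ∀ k : ZMod 3, ∀ x, act (1, 0) x = x → act (k, 0) x = x := by
      intro k x hx
      have : ((k, 0) : ZMod 3 × ZMod 3) = k.val • (1, 0) := by
        revert k
        decide
      rw [this]
      exact hnsmul _ _ hx _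
    have key := eq_self_of_three_fixed_points hs ht (act := fun k => act (k, 0))
      (fun k => hc _) h0 (fun k l x => by rw [← hadd]; simp) hne hne2 hne3
      (fun k => hpow k _ hb) (fun k => hpow k _ (hcomm _ hb))
      (fun k => hpow k _ (hcomm _ (hcomm _ hb))) 1
    exact absurd (hfaith _ key) (by decide)
  have hball : ∀ k, act k b = b := by
    intro k
    have : k = k.1.val • (1, 0) + k.2.val • (0, 1) := by
      revert k
      decide
    rw [this, hadd, hnsmul _ _ hhb, hnsmul _ _ hb]
  obtain ⟨act', h1, h2, h4, h5⟩ := exists_plane_action hs ht hc h0 hadd hball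
  obtain ⟨k, hk, hk'⟩ := exists_ne_zero_forall_eq_self h1 h2 h4
  refine hk (hfaith k fun x => ?_)
  by_cases hx : x = b
  · rw [hx, hball]
  · rw [← chart_symm_apply hs hx, ← h5, hk']
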